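/- Assume f(x,y,z) is convex in y on Y for each fixed (x,z) ∈ X × Z and concave in z on Z for each fixed (x,y) ∈ X × Y, and let γ₁, γ₂ > 0. Then a triple (x*,y*,z*) ∈ X × Y × Z minimizes F over the feasible set {(x,y,z) ∈ X × Y × Z : (y,z) is a saddle point of f(x,·,·) on Y × Z} if and only if it minimizes F over the set {(x,y,z) ∈ X × Y × Z : G^saddle_γ(x,y,z) ≤ 0}; indeed these two feasible sets coincide. -/

import Mathlib

/-- The doubly regularized gap function for a minimax lower-level problem:
`G^saddle_γ(x,y,z) = sup_{θ ∈ Y, λ ∈ Z} [f(x,y,λ) − ‖λ−z‖²/(2γ₂) − f(x,θ,z) − ‖θ−y‖²/(2γ₁)]`. -/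
noncomputable def gapSaddle {n m p : ℕ}
    (f : EuclideanSpace ℝ (Fin n) → EuclideanSpace ℝ (Fin m) → EuclideanSpace ℝ (Fin p) → ℝ)
    (Y : Set (EuclideanSpace ℝ (Fin m))) (Z : Set (EuclideanSpace ℝ (Fin p)))
    (γ1 γ2 : ℝ) (x : EuclideanSpace ℝ (Fin n)) (y : EuclideanSpace ℝ (Fin m))
    (z : EuclideanSpace ℝ (Fin p)) : ℝ :=
  sSup { v : ℝ | ∃ θ ∈ Y, ∃ lam ∈ Z,
    v = f x y lam - ‖lam - z‖ ^ 2 / (2 * γ2) - f x θ z - ‖θ - y‖ ^ 2 / (2 * γ1) }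


/-- A convex function that is continuous at a point of its domain becomes bounded below after
adding a positive multiple of the squared distance to that point. -/
theorem ConvexOn.exists_sub_le_add_mul_norm_sq {E : Type*} [NormedAddCommGroup E]
    [NormedSpace ℝ E] {S : Set E} {g : E → ℝ} {y : E} {c : ℝ} (hg : ConvexOn ℝ S g)
    (hy : y ∈ S) (hcont : ContinuousWithinAt g S y) (hc : 0 < c) :
    ∃ C, ∀ θ ∈ S, g y - C ≤ g θ + c * ‖θ - y‖ ^ 2 := by
  obtain ⟨r, hr, h⟩ := Metric.continuousWithinAt_iff.1 hcont 1 one_pos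
  refine ⟨1 + 1 / (c * r ^ 2), fun θ hθ => ?_⟩
  have hK : 0 < 1 / (c * r ^ 2) := by positivity
  rcases lt_or_ge ‖θ - y‖ r with hd | hd
  · have h1 := h hθ (by rwa [dist_eq_norm])
    rw [Real.dist_eq, abs_lt] at h1
    have : 0 ≤ c * ‖θ - y‖ ^ 2 := by positivity
    linarith
  · set d := ‖θ - y‖ with hd_def
    have hd0 : 0 < d := hr.trans_le hd
    set t := r / (2 * d) with ht_def
    have ht0 : 0 < t := by positivity
    have ht1 : t ≤ 1 := by rw [ht_def, div_le_one (by positivity)]; linarith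
    have hmem := hg.1 hy hθ (sub_nonneg.2 ht1) ht0.le (by ring)
    have hconv := hg.2 hy hθ (sub_nonneg.2 ht1) ht0.le (by ring)
    have hdist : dist ((1 - t) • y + t • θ) y < r := by
      have h2 : (1 - t) • y + t • θ - y = t • (θ - y) := by module
      have h3 : t * d = r / 2 := by rw [ht_def]; field_simp
      rw [dist_eq_norm, h2, norm_smul, Real.norm_of_nonneg ht0.le, ← hd_def, h3]
      linarith
    have h1 := h hmem hdist
    rw [Real.dist_eq, abs_lt] at h1
    simp only [smul_eq_mul] at hconv
    have h4 : -1 < t * (g θ - g y) := by linarith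
    have h5 : -(2 * d / r) < g θ - g y := by
      have h6 : 2 * d / r = 1 / t := by rw [ht_def]; field_simp
      rw [h6, neg_lt, div_eq_mul_inv, one_mul]
      have h7 : -(g θ - g y) * t < 1 := by linarith
      rw [← one_div]
      exact (lt_div_iff₀ ht0).2 h7
    have h8 : c * d ^ 2 - 2 * d / r + 1 / (c * r ^ 2) = (c * r * d - 1) ^ 2 / (c * r ^ 2) := by
      field_simp
      ring
    have h9 : 0 ≤ (c * r * d - 1) ^ 2 / (c * r ^ 2) := by positivity
    linarith

/-- A point of the domain of a convex function that minimizes the proximally regularized function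
centred at that point minimizes the function itself. -/
theorem ConvexOn.le_of_forall_le_add_mul_norm_sq {E : Type*} [NormedAddCommGroup E]
    [NormedSpace ℝ E] {S : Set E} {g : E → ℝ} {y : E} {c : ℝ} (hg : ConvexOn ℝ S g)
    (hy : y ∈ S) (hc : 0 ≤ c) (h : ∀ θ ∈ S, g y ≤ g θ + c * ‖θ - y‖ ^ 2) :
    ∀ θ ∈ S, g y ≤ g θ := by
  intro θ hθ
  by_contra! hlt
  set A := c * ‖θ - y‖ ^ 2 with hA_def
  have hA : 0 ≤ A := by positivity
  obtain ⟨δ, hδ⟩ : ∃ δ, δ = g y - g θ := ⟨_, rfl⟩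
  have hδ0 : 0 < δ := by linarith
  set t := δ / (δ + A) with ht_def
  have ht0 : 0 < t := by positivity
  have ht1 : t ≤ 1 := by rw [ht_def, div_le_one (by positivity)]; linarith
  have hmem := hg.1 hy hθ (sub_nonneg.2 ht1) ht0.le (by ring)
  have hconv := hg.2 hy hθ (sub_nonneg.2 ht1) ht0.le (by ring)
  have h1 := h _ hmem
  have h2 : (1 - t) • y + t • θ - y = t • (θ - y) := by module
  rw [h2, norm_smul, Real.norm_of_nonneg ht0.le] at h1
  simp only [smul_eq_mul] at hconv
  have h3 : t * δ ≤ t * (t * A) := by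
    rw [hδ, hA_def]
    linarith
  have h4 : δ ≤ t * A := le_of_mul_le_mul_left h3 ht0
  have h5 : t * (δ + A) = δ := by rw [ht_def]; field_simp
  have h6 : 0 < t * δ := by positivity
  linarith

/-- Under convexity-concavity and continuity, the doubly regularized gap is nonpositive exactly at
the saddle points. -/
theorem gapSaddle_nonpos_iff {n m p : ℕ}
    {f : EuclideanSpace ℝ (Fin n) → EuclideanSpace ℝ (Fin m) → EuclideanSpace ℝ (Fin p) → ℝ}
    {Y : Set (EuclideanSpace ℝ (Fin m))} {Z : Set (EuclideanSpace ℝ (Fin p))}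
    {γ1 γ2 : ℝ} {x : EuclideanSpace ℝ (Fin n)} {y : EuclideanSpace ℝ (Fin m)}
    {z : EuclideanSpace ℝ (Fin p)} (hγ1 : 0 < γ1) (hγ2 : 0 < γ2) (hy : y ∈ Y) (hz : z ∈ Z)
    (hcv : ConvexOn ℝ Y (fun y => f x y z)) (hcc : ConcaveOn ℝ Z (fun z => f x y z))
    (hcy : ContinuousWithinAt (fun y => f x y z) Y y)
    (hcz : ContinuousWithinAt (fun z => f x y z) Z z) :
    gapSaddle f Y Z γ1 γ2 x y z ≤ 0 ↔
      (∀ z' ∈ Z, f x y z' ≤ f x y z) ∧ ∀ y' ∈ Y, f x y z ≤ f x y' z := by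
  have hc1 : 0 < 1 / (2 * γ1) := by positivity
  have hc2 : 0 < 1 / (2 * γ2) := by positivity
  have hneg : ConvexOn ℝ Z (fun z => -f x y z) := hcc.neg
  constructor
  · intro hgap
    obtain ⟨C1, h1⟩ := hcv.exists_sub_le_add_mul_norm_sq hy hcy hc1
    obtain ⟨C2, h2⟩ := hneg.exists_sub_le_add_mul_norm_sq hz hcz.neg hc2
    have hbdd : BddAbove { v : ℝ | ∃ θ ∈ Y, ∃ lam ∈ Z,
        v = f x y lam - ‖lam - z‖ ^ 2 / (2 * γ2) - f x θ z - ‖θ - y‖ ^ 2 / (2 * γ1) } := by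
      refine ⟨C1 + C2, ?_⟩
      rintro v ⟨θ, hθ, lam, hlam, rfl⟩
      have h3 := h1 θ hθ
      have h4 := h2 lam hlam
      rw [one_div_mul_eq_div] at h3 h4
      linarith
    have hle : ∀ θ ∈ Y, ∀ lam ∈ Z,
        f x y lam - ‖lam - z‖ ^ 2 / (2 * γ2) - f x θ z - ‖θ - y‖ ^ 2 / (2 * γ1) ≤ 0 :=
      fun θ hθ lam hlam => (le_csSup hbdd ⟨θ, hθ, lam, hlam, rfl⟩).trans hgap
    constructor
    · intro z' hz'
      refine neg_le_neg_iff.1 (hneg.le_of_forall_le_add_mul_norm_sq hz hc2.le ?_ z' hz')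
      intro lam hlam
      have h3 := hle y hy lam hlam
      simp only [sub_self, norm_zero] at h3
      rw [one_div_mul_eq_div]
      norm_num at h3
      linarith
    · refine hcv.le_of_forall_le_add_mul_norm_sq hy hc1.le ?_
      intro θ hθ
      have h3 := hle θ hθ z hz
      simp only [sub_self, norm_zero] at h3
      rw [one_div_mul_eq_div]
      norm_num at h3
      linarith
  · rintro ⟨hmax, hmin⟩
    refine Real.sSup_nonpos ?_
    rintro v ⟨θ, hθ, lam, hlam, rfl⟩
    have h1 := hmax lam hlam
    have h2 := hmin θ hθ
    have h3 : 0 ≤ ‖lam - z‖ ^ 2 / (2 * γ2) := by positivity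
    have h4 : 0 ≤ ‖θ - y‖ ^ 2 / (2 * γ1) := by positivity
    linarith

/-- the minimax bilevel feasible set coincides with the set
`{(x,y,z) ∈ X × Y × Z : G^saddle_γ(x,y,z) ≤ 0}`; consequently `(x*,y*,z*)` minimizes `F`
over the one iff it minimizes `F` over the other. -/
theorem minimax_reformulation_equiv {n m p : ℕ}
    (X : Set (EuclideanSpace ℝ (Fin n))) (Y : Set (EuclideanSpace ℝ (Fin m)))
    (Z : Set (EuclideanSpace ℝ (Fin p)))
    (F f : EuclideanSpace ℝ (Fin n) → EuclideanSpace ℝ (Fin m) →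
      EuclideanSpace ℝ (Fin p) → ℝ)
    (γ1 γ2 : ℝ)
    (hXne : X.Nonempty) (hXcl : IsClosed X) (hXcv : Convex ℝ X)
    (hYne : Y.Nonempty) (hYcl : IsClosed Y) (hYcv : Convex ℝ Y)
    (hZne : Z.Nonempty) (hZcl : IsClosed Z) (hZcv : Convex ℝ Z)
    (hγ1 : 0 < γ1) (hγ2 : 0 < γ2)
    (hfC1 : ∃ U, IsOpen U ∧ X ×ˢ Y ×ˢ Z ⊆ U ∧
      ContDiffOn ℝ 1 (fun q : EuclideanSpace ℝ (Fin n) × EuclideanSpace ℝ (Fin m) ×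
        EuclideanSpace ℝ (Fin p) => f q.1 q.2.1 q.2.2) U)
    (hfcv : ∀ x ∈ X, ∀ z ∈ Z, ConvexOn ℝ Y (fun y => f x y z))
    (hfcc : ∀ x ∈ X, ∀ y ∈ Y, ConcaveOn ℝ Z (fun z => f x y z)) :
    ({ w : EuclideanSpace ℝ (Fin n) × EuclideanSpace ℝ (Fin m) × EuclideanSpace ℝ (Fin p) |
        w.1 ∈ X ∧ w.2.1 ∈ Y ∧ w.2.2 ∈ Z ∧
        (∀ z' ∈ Z, f w.1 w.2.1 z' ≤ f w.1 w.2.1 w.2.2) ∧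
        (∀ y' ∈ Y, f w.1 w.2.1 w.2.2 ≤ f w.1 y' w.2.2) } =
      { w : EuclideanSpace ℝ (Fin n) × EuclideanSpace ℝ (Fin m) × EuclideanSpace ℝ (Fin p) |
        w.1 ∈ X ∧ w.2.1 ∈ Y ∧ w.2.2 ∈ Z ∧ gapSaddle f Y Z γ1 γ2 w.1 w.2.1 w.2.2 ≤ 0 })
    ∧
    ∀ ws : EuclideanSpace ℝ (Fin n) × EuclideanSpace ℝ (Fin m) × EuclideanSpace ℝ (Fin p),
      ((ws ∈ { w : EuclideanSpace ℝ (Fin n) × EuclideanSpace ℝ (Fin m) ×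
            EuclideanSpace ℝ (Fin p) |
          w.1 ∈ X ∧ w.2.1 ∈ Y ∧ w.2.2 ∈ Z ∧
          (∀ z' ∈ Z, f w.1 w.2.1 z' ≤ f w.1 w.2.1 w.2.2) ∧
          (∀ y' ∈ Y, f w.1 w.2.1 w.2.2 ≤ f w.1 y' w.2.2) } ∧
        IsMinOn (fun w : EuclideanSpace ℝ (Fin n) × EuclideanSpace ℝ (Fin m) ×
            EuclideanSpace ℝ (Fin p) => F w.1 w.2.1 w.2.2)
          { w | w.1 ∈ X ∧ w.2.1 ∈ Y ∧ w.2.2 ∈ Z ∧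
            (∀ z' ∈ Z, f w.1 w.2.1 z' ≤ f w.1 w.2.1 w.2.2) ∧
            (∀ y' ∈ Y, f w.1 w.2.1 w.2.2 ≤ f w.1 y' w.2.2) } ws)
      ↔
      (ws ∈ { w : EuclideanSpace ℝ (Fin n) × EuclideanSpace ℝ (Fin m) ×
            EuclideanSpace ℝ (Fin p) |
          w.1 ∈ X ∧ w.2.1 ∈ Y ∧ w.2.2 ∈ Z ∧ gapSaddle f Y Z γ1 γ2 w.1 w.2.1 w.2.2 ≤ 0 } ∧
        IsMinOn (fun w : EuclideanSpace ℝ (Fin n) × EuclideanSpace ℝ (Fin m) ×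
            EuclideanSpace ℝ (Fin p) => F w.1 w.2.1 w.2.2)
          { w | w.1 ∈ X ∧ w.2.1 ∈ Y ∧ w.2.2 ∈ Z ∧
            gapSaddle f Y Z γ1 γ2 w.1 w.2.1 w.2.2 ≤ 0 } ws)) := by
  have key : { w : EuclideanSpace ℝ (Fin n) × EuclideanSpace ℝ (Fin m) ×
          EuclideanSpace ℝ (Fin p) |
        w.1 ∈ X ∧ w.2.1 ∈ Y ∧ w.2.2 ∈ Z ∧
        (∀ z' ∈ Z, f w.1 w.2.1 z' ≤ f w.1 w.2.1 w.2.2) ∧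
        (∀ y' ∈ Y, f w.1 w.2.1 w.2.2 ≤ f w.1 y' w.2.2) } =
      { w : EuclideanSpace ℝ (Fin n) × EuclideanSpace ℝ (Fin m) × EuclideanSpace ℝ (Fin p) |
        w.1 ∈ X ∧ w.2.1 ∈ Y ∧ w.2.2 ∈ Z ∧ gapSaddle f Y Z γ1 γ2 w.1 w.2.1 w.2.2 ≤ 0 } := by
    obtain ⟨U, hU, hsub, hC1⟩ := hfC1
    ext ⟨x, y, z⟩
    simp only [Set.mem_ofPred_eq]
    refine and_congr_right fun hx => and_congr_right fun hy => and_congr_right fun hz => ?_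
    have hmem : (x, y, z) ∈ U := hsub ⟨hx, hy, hz⟩
    have hcont := hC1.continuousOn.continuousAt (hU.mem_nhds hmem)
    refine (gapSaddle_nonpos_iff hγ1 hγ2 hy hz (hfcv x hx z hz) (hfcc x hx y hy) ?_ ?_).symm
    · exact (hcont.comp (f := fun y' => (x, y', z))
        (by fun_prop : Continuous _).continuousAt).continuousWithinAt
    · exact (hcont.comp (f := fun z' => (x, y, z'))
        (by fun_prop : Continuous _).continuousAt).continuousWithinAt
  exact ⟨key, fun ws => by rw [key]⟩
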